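/- Let g ≥ 2 and let d ≥ 2 be even. The map m'_1 : Γ_g[d²] → (ℤ/2ℤ)^{2g} defined on A = I + d²A' by m'_1(A) := ({q_{ii}(A) mod 2}_{i=1}^g, {r_{ii}(A) mod 2}_{i=1}^g) is a surjective group homomorphism with kernel Γ_g[d²,2d²]; hence it induces an isomorphism Γ_g[d²]/Γ_g[d²,2d²] ≅ (ℤ/2ℤ)^{2g}. -/

import Mathlib

open Matrix

/-- The index type for `2g × 2g` matrices, written as `Fin g ⊕ Fin g`. -/
abbrev Idx (g : ℕ) := Fin g ⊕ Fin g

/-- The integral symplectic group `Sp(2g; ℤ)`. -/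
abbrev SpZ (g : ℕ) := Matrix.symplecticGroup (Fin g) ℤ

/-- Entrywise reduction of integral matrices mod `d`. -/
def modred (g d : ℕ) : Matrix (Idx g) (Idx g) ℤ →+* Matrix (Idx g) (Idx g) (ZMod d) :=
  (Int.castRingHom (ZMod d)).mapMatrix

/-- The level `d` congruence subgroup `Γ_g[d]` of `Sp(2g; ℤ)`:
matrices congruent to the identity mod `d`. -/
def Gamma (g d : ℕ) : Subgroup ↥(SpZ g) where
  carrier := {A | modred g d (A : Matrix (Idx g) (Idx g) ℤ) = 1}
  one_mem' := by
    simp [Set.mem_setOf_eq]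
  mul_mem' := by
    intro a b ha hb
    simp only [Set.mem_setOf_eq, Submonoid.coe_mul, _root_.map_mul] at *
    rw [ha, hb, one_mul]
  inv_mem' := by
    intro a ha
    simp only [Set.mem_setOf_eq] at *
    have h : modred g d ((a⁻¹ : ↥(SpZ g)) : Matrix (Idx g) (Idx g) ℤ) *
        modred g d ((a : ↥(SpZ g)) : Matrix (Idx g) (Idx g) ℤ) = 1 := by
      rw [← _root_.map_mul, ← Submonoid.coe_mul, inv_mul_cancel, Submonoid.coe_one, _root_.map_one]
    calc modred g d ((a⁻¹ : ↥(SpZ g)) : Matrix (Idx g) (Idx g) ℤ)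
        = modred g d ((a⁻¹ : ↥(SpZ g)) : Matrix (Idx g) (Idx g) ℤ) *
            modred g d ((a : ↥(SpZ g)) : Matrix (Idx g) (Idx g) ℤ) := by rw [ha, mul_one]
      _ = 1 := h

lemma mem_Gamma_iff {g d : ℕ} {A : ↥(SpZ g)} :
    A ∈ Gamma g d ↔ ∀ i j : Idx g, (d : ℤ) ∣
      ((A : Matrix (Idx g) (Idx g) ℤ) i j - (1 : Matrix (Idx g) (Idx g) ℤ) i j) := by
  have : A ∈ Gamma g d ↔ modred g d (A : Matrix (Idx g) (Idx g) ℤ) = 1 := Iff.rfl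
  rw [this, ← Matrix.ext_iff]
  constructor
  · intro h i j
    have hij := h i j
    simp only [modred, RingHom.mapMatrix_apply, Matrix.map_apply, Int.coe_castRingHom] at hij
    have h1 : ((1 : Matrix (Idx g) (Idx g) ℤ) i j : ZMod d) = (1 : Matrix (Idx g) (Idx g) (ZMod d)) i j := by
      by_cases hij' : i = j <;> simp [Matrix.one_apply, hij']
    rw [← h1] at hij
    rw [← ZMod.intCast_zmod_eq_zero_iff_dvd]
    push_cast
    rw [hij]
    ring
  · intro h i j
    have hij := h i j
    rw [← ZMod.intCast_zmod_eq_zero_iff_dvd] at hij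
    push_cast at hij
    simp only [modred, RingHom.mapMatrix_apply, Matrix.map_apply, Int.coe_castRingHom]
    have h1 : ((1 : Matrix (Idx g) (Idx g) ℤ) i j : ZMod d) = (1 : Matrix (Idx g) (Idx g) (ZMod d)) i j := by
      by_cases hij' : i = j <;> simp [Matrix.one_apply, hij']
    rw [← h1]
    linear_combination hij
lemma Gamma_entry_dvd {g d : ℕ} {A : ↥(SpZ g)} (hA : A ∈ Gamma g d) {i j : Idx g}
    (hij : i ≠ j) : (d : ℤ) ∣ (A : Matrix (Idx g) (Idx g) ℤ) i j := by
  have := mem_Gamma_iff.mp hA i j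
  rwa [Matrix.one_apply_ne hij, sub_zero] at this

lemma Gamma_one_sub_dvd {g d : ℕ} {A : ↥(SpZ g)} (hA : A ∈ Gamma g d) (i j : Idx g) :
    (d : ℤ) ∣ ((1 : Matrix (Idx g) (Idx g) ℤ) - (A : Matrix (Idx g) (Idx g) ℤ)) i j := by
  have h := mem_Gamma_iff.mp hA i j
  have he : ((1 : Matrix (Idx g) (Idx g) ℤ) - (A : Matrix (Idx g) (Idx g) ℤ)) i j
      = -((A : Matrix (Idx g) (Idx g) ℤ) i j - (1 : Matrix (Idx g) (Idx g) ℤ) i j) := by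
    rw [Matrix.sub_apply]; ring
  rw [he]
  exact dvd_neg.mpr h

lemma two_d_dvd_d_mul_d {d : ℕ} (hd : Even d) : (2 * d : ℤ) ∣ (d : ℤ) * (d : ℤ) := by
  obtain ⟨e, he⟩ := hd
  refine ⟨(e : ℤ), ?_⟩
  push_cast [he]
  ring

/-- The subgroup `Γ_g[d, 2d]` (for even `d`) of `Γ_g[d]`: matrices `A = I + dA'` such that
the diagonal entries of the upper-right and lower-left `g×g` blocks of `A'` are even,
i.e. the `(inl i, inr i)` and `(inr i, inl i)` entries of `A` are divisible by `2d`. -/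
def GammaMod (g : ℕ) (d : ℕ) (hd : Even d) : Subgroup ↥(SpZ g) where
  carrier := {A | A ∈ Gamma g d ∧ ∀ i : Fin g,
    (2 * d : ℤ) ∣ (A : Matrix (Idx g) (Idx g) ℤ) (Sum.inl i) (Sum.inr i) ∧
    (2 * d : ℤ) ∣ (A : Matrix (Idx g) (Idx g) ℤ) (Sum.inr i) (Sum.inl i)}
  one_mem' := by
    refine ⟨one_mem _, fun i => ?_⟩
    constructor <;> simp [Matrix.one_apply]
  mul_mem' := by
    rintro a b ⟨ha1, ha2⟩ ⟨hb1, hb2⟩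
    refine ⟨mul_mem ha1 hb1, fun i => ?_⟩
    constructor
    · rw [Submonoid.coe_mul, Matrix.mul_apply]
      refine Finset.dvd_sum fun k _ => ?_
      rcases k with k | k
      · by_cases hk : k = i
        · subst hk
          exact Dvd.dvd.mul_left (hb2 k).1 _
        · refine dvd_trans (two_d_dvd_d_mul_d hd) (mul_dvd_mul ?_ ?_)
          · exact Gamma_entry_dvd ha1 (by simp only [ne_eq, Sum.inl.injEq, Sum.inr.injEq]; first | exact fun h => hk h | exact fun h => hk h.symm)
          · exact Gamma_entry_dvd hb1 (by simp)
      · by_cases hk : k = i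
        · subst hk
          exact Dvd.dvd.mul_right (ha2 k).1 _
        · refine dvd_trans (two_d_dvd_d_mul_d hd) (mul_dvd_mul ?_ ?_)
          · exact Gamma_entry_dvd ha1 (by simp)
          · exact Gamma_entry_dvd hb1 (by simp only [ne_eq, Sum.inl.injEq, Sum.inr.injEq]; first | exact fun h => hk h | exact fun h => hk h.symm)
    · rw [Submonoid.coe_mul, Matrix.mul_apply]
      refine Finset.dvd_sum fun k _ => ?_
      rcases k with k | k
      · by_cases hk : k = i
        · subst hk
          exact Dvd.dvd.mul_right (ha2 k).2 _
        · refine dvd_trans (two_d_dvd_d_mul_d hd) (mul_dvd_mul ?_ ?_)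
          · exact Gamma_entry_dvd ha1 (by simp)
          · exact Gamma_entry_dvd hb1 (by simp only [ne_eq, Sum.inl.injEq, Sum.inr.injEq]; first | exact fun h => hk h | exact fun h => hk h.symm)
      · by_cases hk : k = i
        · subst hk
          exact Dvd.dvd.mul_left (hb2 k).2 _
        · refine dvd_trans (two_d_dvd_d_mul_d hd) (mul_dvd_mul ?_ ?_)
          · exact Gamma_entry_dvd ha1 (by simp only [ne_eq, Sum.inl.injEq, Sum.inr.injEq]; first | exact fun h => hk h | exact fun h => hk h.symm)
          · exact Gamma_entry_dvd hb1 (by simp)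
  inv_mem' := by
    rintro a ⟨ha1, ha2⟩
    refine ⟨inv_mem ha1, fun i => ?_⟩
    have hAA : ((a : ↥(SpZ g)) : Matrix (Idx g) (Idx g) ℤ) *
        ((a⁻¹ : ↥(SpZ g)) : Matrix (Idx g) (Idx g) ℤ) = 1 := by
      rw [← Submonoid.coe_mul, mul_inv_cancel, Submonoid.coe_one]
    have hAA' : ((a⁻¹ : ↥(SpZ g)) : Matrix (Idx g) (Idx g) ℤ) *
        ((a : ↥(SpZ g)) : Matrix (Idx g) (Idx g) ℤ) = 1 := by
      rw [← Submonoid.coe_mul, inv_mul_cancel, Submonoid.coe_one]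
    set X : Matrix (Idx g) (Idx g) ℤ := ((a⁻¹ : ↥(SpZ g)) : Matrix (Idx g) (Idx g) ℤ) with hX
    set A : Matrix (Idx g) (Idx g) ℤ := ((a : ↥(SpZ g)) : Matrix (Idx g) (Idx g) ℤ) with hA
    have key : X = (2 : ℤ) • (1 : Matrix (Idx g) (Idx g) ℤ) - A + (1 - A) * X * (1 - A) := by
      have e1 : ((1 : Matrix (Idx g) (Idx g) ℤ) - A) * X = X - 1 := by
        rw [sub_mul, one_mul, hAA]
      have e2 : (X - 1) * ((1 : Matrix (Idx g) (Idx g) ℤ) - A) = X - 1 - (1 - A) := by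
        rw [sub_mul, one_mul, mul_sub, mul_one, hAA']
      rw [e1, e2]
      have : (2 : ℤ) • (1 : Matrix (Idx g) (Idx g) ℤ) = 1 + 1 := by
        rw [two_smul]
      rw [this]
      abel
    have hprod : ∀ i' j' : Idx g, (2 * d : ℤ) ∣ ((1 - A) * X * (1 - A)) i' j' := by
      intro i' j'
      rw [Matrix.mul_apply]
      refine Finset.dvd_sum fun k _ => ?_
      refine dvd_trans (two_d_dvd_d_mul_d hd) (mul_dvd_mul ?_ ?_)
      · rw [Matrix.mul_apply]
        refine Finset.dvd_sum fun l _ => ?_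
        exact Dvd.dvd.mul_right (Gamma_one_sub_dvd ha1 i' l) _
      · exact Gamma_one_sub_dvd ha1 k j'
    constructor
    · rw [key]
      simp only [Matrix.add_apply, Matrix.sub_apply, Matrix.smul_apply,
        Matrix.one_apply_ne (show (Sum.inl i : Idx g) ≠ Sum.inr i by simp), smul_zero]
      refine dvd_add (dvd_sub (Dvd.intro 0 rfl) ?_) (hprod _ _)
      exact (ha2 i).1
    · rw [key]
      simp only [Matrix.add_apply, Matrix.sub_apply, Matrix.smul_apply,
        Matrix.one_apply_ne (show (Sum.inr i : Idx g) ≠ Sum.inl i by simp), smul_zero]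
      refine dvd_add (dvd_sub (Dvd.intro 0 rfl) ?_) (hprod _ _)
      exact (ha2 i).2

/-- The `(i,j)` entry of the matrix `A' = (A - I)/d`. -/
def entryDiv (g d : ℕ) (A : ↥(SpZ g)) (i j : Idx g) : ℤ :=
  ((A : Matrix (Idx g) (Idx g) ℤ) i j - (1 : Matrix (Idx g) (Idx g) ℤ) i j) / (d : ℤ)

/-- The map `m'_1 : Γ_g[d²] → (ℤ/2ℤ)^{2g}` given by the diagonal entries of the `q`- and
`r`-blocks of `A' = (A - I)/d²`, reduced mod 2. -/
def m1Map (g d : ℕ) (A : ↥(Gamma g (d ^ 2))) : (Fin g → ZMod 2) × (Fin g → ZMod 2) :=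
  ⟨fun i => (entryDiv g (d ^ 2) (A : ↥(SpZ g)) (Sum.inl i) (Sum.inr i) : ZMod 2),
   fun i => (entryDiv g (d ^ 2) (A : ↥(SpZ g)) (Sum.inr i) (Sum.inl i) : ZMod 2)⟩

lemma coe_eq_one_add_mul_entryDiv {g n : ℕ} {A : ↥(SpZ g)} (hA : A ∈ Gamma g n) (i j : Idx g) :
    (A : Matrix (Idx g) (Idx g) ℤ) i j =
      (1 : Matrix (Idx g) (Idx g) ℤ) i j + n * entryDiv g n A i j := by
  rw [entryDiv, Int.mul_ediv_cancel' (mem_Gamma_iff.mp hA i j)]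
  ring

lemma entryDiv_eq_of_coe_eq {g n : ℕ} (hn : n ≠ 0) {A : ↥(SpZ g)} {i j : Idx g} {x : ℤ}
    (h : (A : Matrix (Idx g) (Idx g) ℤ) i j = (1 : Matrix (Idx g) (Idx g) ℤ) i j + n * x) :
    entryDiv g n A i j = x := by
  rw [entryDiv, h, add_sub_cancel_left, Int.mul_ediv_cancel_left _ (by exact_mod_cast hn)]

/-- The matrices `A' = (A - I)/n` satisfy `(AB)' = A' + B' + n A'B'`. -/
lemma entryDiv_mul {g n : ℕ} (hn : n ≠ 0) {A B : ↥(SpZ g)} (hA : A ∈ Gamma g n)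
    (hB : B ∈ Gamma g n) (i j : Idx g) :
    entryDiv g n (A * B) i j = entryDiv g n A i j + entryDiv g n B i j +
      n * ∑ k, entryDiv g n A i k * entryDiv g n B k j := by
  have matrix_eq : ∀ {C : ↥(SpZ g)}, C ∈ Gamma g n → (C : Matrix (Idx g) (Idx g) ℤ) =
      1 + (n : ℤ) • Matrix.of (entryDiv g n C) := by
    intro C hC
    ext i j
    simp [coe_eq_one_add_mul_entryDiv hC i j]
  apply entryDiv_eq_of_coe_eq hn
  have hmul : (1 + (n : ℤ) • Matrix.of (entryDiv g n A)) *
      (1 + (n : ℤ) • Matrix.of (entryDiv g n B)) =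
      1 + (n : ℤ) • (Matrix.of (entryDiv g n A) + Matrix.of (entryDiv g n B) +
        (n : ℤ) • (Matrix.of (entryDiv g n A) * Matrix.of (entryDiv g n B))) := by
    simp only [add_mul, mul_add, one_mul, mul_one, smul_mul_assoc, mul_smul_comm, smul_add]
    abel
  rw [Submonoid.coe_mul, matrix_eq hA, matrix_eq hB, hmul]
  simp only [Matrix.add_apply, Matrix.smul_apply, Matrix.of_apply, Matrix.mul_apply, smul_eq_mul]

lemma entryDiv_mul_cast {g n : ℕ} (hn : n ≠ 0) (heven : Even n) {A B : ↥(SpZ g)}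
    (hA : A ∈ Gamma g n) (hB : B ∈ Gamma g n) (i j : Idx g) :
    (entryDiv g n (A * B) i j : ZMod 2) = entryDiv g n A i j + entryDiv g n B i j := by
  have h0 : (n : ZMod 2) = 0 := (ZMod.natCast_eq_zero_iff_even).mpr heven
  rw [entryDiv_mul hn hA hB]
  push_cast
  rw [h0, zero_mul, add_zero]

lemma entryDiv_cast_eq_zero_iff {g n : ℕ} (hn : n ≠ 0) {A : ↥(SpZ g)} (hA : A ∈ Gamma g n)
    {i j : Idx g} (hij : i ≠ j) :
    (entryDiv g n A i j : ZMod 2) = 0 ↔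
      (2 * n : ℤ) ∣ (A : Matrix (Idx g) (Idx g) ℤ) i j := by
  rw [coe_eq_one_add_mul_entryDiv hA, Matrix.one_apply_ne hij, zero_add, mul_comm (2 : ℤ),
    mul_dvd_mul_iff_left (by exact_mod_cast hn), ZMod.intCast_zmod_eq_zero_iff_dvd]
  rfl

/-- The unipotent symplectic matrix with upper-right block `diagonal v`. -/
def upperUnipotent {g : ℕ} (v : Fin g → ℤ) : ↥(SpZ g) :=
  ⟨fromBlocks 1 (diagonal v) 0 1, by
    rw [SymplecticGroup.mem_iff, J]
    simp [fromBlocks_transpose, fromBlocks_multiply]⟩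

/-- The unipotent symplectic matrix with lower-left block `diagonal v`. -/
def lowerUnipotent {g : ℕ} (v : Fin g → ℤ) : ↥(SpZ g) :=
  ⟨fromBlocks 1 0 (diagonal v) 1, by
    rw [SymplecticGroup.mem_iff, J]
    simp [fromBlocks_transpose, fromBlocks_multiply]⟩

lemma upperUnipotent_mem_Gamma {g : ℕ} (n : ℕ) (v : Fin g → ℤ) :
    upperUnipotent (fun i => n * v i) ∈ Gamma g n := by
  rw [mem_Gamma_iff, ← fromBlocks_one]
  rintro (i | i) (j | j) <;> simp [upperUnipotent, diagonal_apply, apply_ite]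

lemma lowerUnipotent_mem_Gamma {g : ℕ} (n : ℕ) (v : Fin g → ℤ) :
    lowerUnipotent (fun i => n * v i) ∈ Gamma g n := by
  rw [mem_Gamma_iff, ← fromBlocks_one]
  rintro (i | i) (j | j) <;> simp [lowerUnipotent, diagonal_apply, apply_ite]

lemma m1Map_mul {g d : ℕ} (hd : d ≠ 0) (hdeven : Even d) (A B : ↥(Gamma g (d ^ 2))) :
    m1Map g d (A * B) = m1Map g d A + m1Map g d B := by
  have key := entryDiv_mul_cast (pow_ne_zero 2 hd) (hdeven.pow_of_ne_zero two_ne_zero) A.2 B.2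
  ext i
  · exact key (Sum.inl i) (Sum.inr i)
  · exact key (Sum.inr i) (Sum.inl i)

lemma m1Map_upperUnipotent {g d : ℕ} (hd : d ≠ 0) (v : Fin g → ℤ) :
    m1Map g d ⟨_, upperUnipotent_mem_Gamma (d ^ 2) v⟩ = (fun i => (v i : ZMod 2), 0) := by
  ext i
  · refine congrArg (Int.cast : ℤ → ZMod 2) (entryDiv_eq_of_coe_eq (pow_ne_zero 2 hd) ?_)
    simp [upperUnipotent]
  · refine (congrArg _ (entryDiv_eq_of_coe_eq (x := 0) (pow_ne_zero 2 hd) ?_)).trans Int.cast_zero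
    simp [upperUnipotent]

lemma m1Map_lowerUnipotent {g d : ℕ} (hd : d ≠ 0) (v : Fin g → ℤ) :
    m1Map g d ⟨_, lowerUnipotent_mem_Gamma (d ^ 2) v⟩ = (0, fun i => (v i : ZMod 2)) := by
  ext i
  · refine (congrArg _ (entryDiv_eq_of_coe_eq (x := 0) (pow_ne_zero 2 hd) ?_)).trans Int.cast_zero
    simp [lowerUnipotent]
  · refine congrArg (Int.cast : ℤ → ZMod 2) (entryDiv_eq_of_coe_eq (pow_ne_zero 2 hd) ?_)
    simp [lowerUnipotent]

lemma m1Map_surjective {g d : ℕ} (hd : d ≠ 0) (hdeven : Even d) :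
    Function.Surjective (m1Map g d) := by
  rintro ⟨x, y⟩
  choose lift hlift using ZMod.intCast_surjective (n := 2)
  refine ⟨⟨_, upperUnipotent_mem_Gamma (d ^ 2) (lift ∘ x)⟩ *
    ⟨_, lowerUnipotent_mem_Gamma (d ^ 2) (lift ∘ y)⟩, ?_⟩
  rw [m1Map_mul hd hdeven, m1Map_upperUnipotent hd, m1Map_lowerUnipotent hd]
  simp [hlift]

lemma m1Map_eq_zero_iff {g d : ℕ} (hd : d ≠ 0) (heven : Even (d ^ 2))
    (A : ↥(Gamma g (d ^ 2))) :
    m1Map g d A = 0 ↔ (A : ↥(SpZ g)) ∈ GammaMod g (d ^ 2) heven := by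
  have key := fun i j => entryDiv_cast_eq_zero_iff (pow_ne_zero 2 hd) A.2 (i := i) (j := j)
  have hmem : (A : ↥(SpZ g)) ∈ GammaMod g (d ^ 2) heven ↔ _ ∧ _ := Iff.rfl
  rw [hmem, and_iff_right A.2, Prod.ext_iff, funext_iff, funext_iff, ← forall_and]
  exact forall_congr' fun i => and_congr (key _ _ Sum.inl_ne_inr) (key _ _ Sum.inr_ne_inl)

/-- For even `d ≥ 2` and `g ≥ 2`, the map `m'_1` is a surjective group homomorphism with
kernel `Γ_g[d², 2d²]`; hence it induces an isomorphism `Γ_g[d²]/Γ_g[d²,2d²] ≅ (ℤ/2ℤ)^{2g}`. -/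
theorem m1Map_hom_surjective_ker (g d : ℕ) (hg : 2 ≤ g) (hd : 2 ≤ d) (hdeven : Even d) :
    (∀ A B : ↥(Gamma g (d ^ 2)), m1Map g d (A * B) = m1Map g d A + m1Map g d B) ∧
    Function.Surjective (m1Map g d) ∧
    (∀ A : ↥(Gamma g (d ^ 2)), m1Map g d A = 0 ↔
      (A : ↥(SpZ g)) ∈ GammaMod g (d ^ 2) (by rw [pow_two]; exact hdeven.mul_right d)) := by
  have hd0 : d ≠ 0 := by lia
  exact ⟨m1Map_mul hd0 hdeven, m1Map_surjective hd0 hdeven, m1Map_eq_zero_iff hd0 _⟩
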